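/- arXiv:1412.1905 — 4 statements merged into one kernel-verified Lean document; each statement's English description precedes it below -/
import Mathlib

section
/- Let R ∈ ℤ[q] be a reciprocal (palindromic) polynomial of odd degree d, i.e. R ≠ 0, R(0) ≠ 0, and R.coeff k = R.coeff (d-k) for all k ≤ d. Then there exists a polynomial b ∈ ℤ[x] such that, in the ring of Laurent polynomials ℤ[t, t⁻¹], one has R(-t²) = t^d · (t⁻¹ - t) · b((t⁻¹ - t)²). Equivalently, with q = t² and z = t⁻¹ - t, the Laurent polynomial R(-q)/q^{d/2} equals z·b(z²). -/
open Polynomial LaurentPolynomial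

theorem exists_aeval_sq_eq_pow_sub_pow {S A : Type*} [CommRing S] [CommRing A] [Algebra S A]
    (j : ℕ) :
    ∃ b : Polynomial S, ∀ u v : A, u * v = 1 →
      v ^ (2 * j + 1) - u ^ (2 * j + 1) = (v - u) * Polynomial.aeval ((v - u) ^ 2) b := by
  induction j using Nat.twoStepInduction with
  | zero => exact ⟨1, by simp⟩
  | one =>
    refine ⟨X + 3, fun u v h => ?_⟩
    simp only [map_add, aeval_X, map_ofNat]
    linear_combination (3 * v - 3 * u) * h
  | more n ih₀ ih₁ =>
    obtain ⟨b₀, h₀⟩ := ih₀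
    obtain ⟨b₁, h₁⟩ := ih₁
    refine ⟨(X + 2) * b₁ - b₀, fun u v h => ?_⟩
    have e₀ := h₀ u v h
    have e₁ := h₁ u v h
    simp only [map_add, map_sub, map_mul, aeval_X, map_ofNat]
    linear_combination ((v - u) ^ 2 + 2) * e₁ - e₀ +
      (2 * (v ^ (2 * n + 3) - u ^ (2 * n + 3))
        - (u * v + 1) * (v ^ (2 * n + 1) - u ^ (2 * n + 1))) * h

theorem neg_sq_pow_add_neg_sq_pow {A : Type*} [CommRing A] {u v : A} (h : u * v = 1)
    (k j : ℕ) :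
    (-u ^ 2) ^ k + (-u ^ 2) ^ (k + 2 * j + 1) =
      u ^ (2 * (k + j) + 1) * ((-1) ^ k * (v ^ (2 * j + 1) - u ^ (2 * j + 1))) := by
  have hp : u ^ (2 * j + 1) * v ^ (2 * j + 1) = 1 := by rw [← mul_pow, h, one_pow]
  have hs : (-1 : A) ^ (2 * j) = 1 := by simp
  rw [neg_pow (u ^ 2) k, neg_pow (u ^ 2) (k + 2 * j + 1), pow_succ (-1 : A), pow_add (-1 : A), hs]
  linear_combination (-(-1) ^ k * u ^ (2 * k)) * hp

theorem sum_range_two_mul_eq_sum_add_reflect {M : Type*} [AddCommMonoid M] (f : ℕ → M) (n : ℕ) :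
    ∑ k ∈ Finset.range (2 * n), f k = ∑ k ∈ Finset.range n, (f k + f (2 * n - 1 - k)) := by
  rw [two_mul, Finset.sum_range_add, Finset.sum_add_distrib,
    ← Finset.sum_range_reflect (fun k => f (n + k))]
  congr 1
  refine Finset.sum_congr rfl fun k hk => ?_
  rw [Finset.mem_range] at hk
  congr 1
  omega

/-- If `R ∈ ℤ[q]` is a reciprocal (palindromic) polynomial of odd degree `d`, then there is
`b ∈ ℤ[x]` such that in `ℤ[t,t⁻¹]` one has `R(-t²) = t^d · (t⁻¹ - t) · b((t⁻¹ - t)²)`,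
i.e. `R(-q)/q^{d/2} = z·b(z²)` with `q = t²`, `z = t⁻¹ - t`. -/
theorem reciprocal_odd_degree_eq_z_mul_poly_in_z_sq
    (R : Polynomial ℤ) (hR : R ≠ 0) (h0 : R.coeff 0 ≠ 0)
    (hodd : Odd R.natDegree)
    (hpal : ∀ k ≤ R.natDegree, R.coeff k = R.coeff (R.natDegree - k)) :
    ∃ b : Polynomial ℤ,
      Polynomial.aeval (-(T 2 : ℤ[T;T⁻¹])) R =
        T (R.natDegree : ℤ) * (T (-1) - T 1) *
          Polynomial.aeval ((T (-1) - T 1 : ℤ[T;T⁻¹]) ^ 2) b := by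
  obtain ⟨m, hm⟩ := hodd
  choose β hβ using exists_aeval_sq_eq_pow_sub_pow (S := ℤ) (A := ℤ[T;T⁻¹])
  have huv : (T 1 * T (-1) : ℤ[T;T⁻¹]) = 1 := by rw [← T_add]; simp
  have hT (n : ℕ) : (T (n : ℤ) : ℤ[T;T⁻¹]) = T 1 ^ n := by rw [T_pow, mul_one]
  have hT2 : (T 2 : ℤ[T;T⁻¹]) = T 1 ^ 2 := hT 2
  refine ⟨∑ k ∈ Finset.range (m + 1), (R.coeff k * (-1) ^ k) • β (m - k), ?_⟩
  rw [aeval_eq_sum_range, hT, hT2, hm, show 2 * m + 1 + 1 = 2 * (m + 1) by ring,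
    sum_range_two_mul_eq_sum_add_reflect, map_sum, Finset.mul_sum]
  refine Finset.sum_congr rfl fun k hk => ?_
  obtain ⟨j, rfl⟩ := Nat.exists_eq_add_of_le (Nat.lt_succ_iff.mp (Finset.mem_range.mp hk))
  have hr : 2 * (k + j + 1) - 1 - k = k + 2 * j + 1 := by omega
  have hc : R.coeff (k + 2 * j + 1) = R.coeff k := by
    rw [hpal k (by omega), hm]
    congr 1
    omega
  rw [hr, hc, ← smul_add, neg_sq_pow_add_neg_sq_pow huv, hβ j _ _ huv, Nat.add_sub_cancel_left,
    map_smul, Algebra.smul_def, Algebra.smul_def, map_mul, map_pow, map_neg, map_one]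
  ring
end

section
/- Let n be odd, let g be an element of the special unitary group SU(n), and let f ∈ ℂ[q] be the characteristic polynomial of g. If all coefficients of f are real, then f(1) = 0, i.e. f is divisible by 1 - q (equivalently, 1 is an eigenvalue of g). -/
open Polynomial

/-- For odd `n` and `g ∈ SU(n)`, the number `det (1 - g)` is purely imaginary. -/
theorem star_det_one_sub_of_mem_specialUnitaryGroup {n : ℕ} (hn : Odd n)
    {g : Matrix (Fin n) (Fin n) ℂ} (hg : g ∈ Matrix.specialUnitaryGroup (Fin n) ℂ) :
    star (1 - g).det = -(1 - g).det := by
  obtain ⟨hU, hdet⟩ := Matrix.mem_specialUnitaryGroup_iff.mp hg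
  have hmul : star g * g = 1 := Matrix.mem_unitaryGroup_iff'.mp hU
  have hstar : (star g).det = 1 := by
    rw [Matrix.star_eq_conjTranspose, Matrix.det_conjTranspose, hdet, star_one]
  calc star (1 - g).det = (star (1 - g)).det := by
        rw [Matrix.star_eq_conjTranspose, Matrix.det_conjTranspose]
    _ = (star g * -(1 - g)).det := by
        congr 1
        rw [neg_sub, mul_sub, hmul, mul_one, star_sub, star_one]
    _ = -(1 - g).det := by
        rw [Matrix.det_mul, hstar, Matrix.det_neg, Fintype.card_fin, hn.neg_one_pow]
        ring

theorem Polynomial.star_eval_one_of_coeff_im_eq_zero {f : ℂ[X]}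
    (hf : ∀ k, (f.coeff k).im = 0) : star (f.eval 1) = f.eval 1 := by
  simp only [eval_eq_sum, Polynomial.sum, one_pow, mul_one, star_sum]
  exact Finset.sum_congr rfl fun k _ => Complex.conj_eq_iff_im.mpr (hf k)

/-- If `n` is odd, `g ∈ SU(n)` and the characteristic polynomial `f` of `g` has real
coefficients, then `f(1) = 0`, i.e. `1` is an eigenvalue of `g`. -/
theorem charpoly_specialUnitary_odd_real_eval_one
    (n : ℕ) (hn : Odd n) (g : Matrix.specialUnitaryGroup (Fin n) ℂ)
    (f : Polynomial ℂ) (hf : f = Matrix.charpoly (g : Matrix (Fin n) (Fin n) ℂ))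
    (hreal : ∀ k, (f.coeff k).im = 0) :
    f.eval 1 = 0 := by
  have heval : f.eval 1 = (1 - (g : Matrix (Fin n) (Fin n) ℂ)).det := by
    rw [hf, Matrix.eval_charpoly, map_one]
  have h := Polynomial.star_eval_one_of_coeff_im_eq_zero hreal
  rw [heval, star_det_one_sub_of_mem_specialUnitaryGroup hn g.2] at h
  rw [heval]
  exact self_eq_neg.mp h.symm
end

section
/- Let n be odd, let g be an element of the special unitary group SU(n), and let f ∈ ℂ[q] be the characteristic polynomial of g, assumed to have only real coefficients. Then there exists a polynomial h ∈ ℂ[q] of degree n - 1 such that f(q) = (1 - q)·h(q) and h is reciprocal: h.coeff k = h.coeff (n-1-k) for all 0 ≤ k ≤ n-1. -/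
open Polynomial

/-- The characteristic polynomial of a conjugate transpose is obtained by conjugating the
coefficients. -/
lemma Matrix.charpoly_conjTranspose_eq_map {m R : Type*} [Fintype m] [DecidableEq m]
    [CommRing R] [StarRing R] (A : Matrix m m R) :
    A.conjTranspose.charpoly = A.charpoly.map (starRingEnd R) := by
  rw [← Matrix.charpoly_transpose A, ← Matrix.charpoly_map]
  rfl

/-- An antireciprocal polynomial is `1 - X` times a polynomial equal to its own reverse. -/
lemma Polynomial.exists_eq_one_sub_X_mul_of_reverse_eq_neg {R : Type*} [CommRing R] [IsDomain R]
    [NeZero (2 : R)] {f : R[X]} (hf : f.reverse = -f) :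
    ∃ h : R[X], f = (1 - X) * h ∧ h.reverse = h := by
  have hroot : f.eval 1 = 0 := by
    let _ : Invertible (1 : R) := invertibleOne
    have key := eval₂_reverse_mul_pow (RingHom.id R) 1 f
    simp only [invOf_one, one_pow, mul_one, hf, eval₂_id, eval_neg] at key
    have h2 : (2 : R) * f.eval 1 = 0 := by linear_combination -key
    exact (mul_eq_zero.mp h2).resolve_left two_ne_zero
  obtain ⟨k, hk⟩ := dvd_iff_isRoot.mpr hroot
  have hfk : f = (1 - X) * -k := by rw [hk, C_1]; ring
  refine ⟨-k, hfk, ?_⟩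
  have hne : (1 - X : R[X]) ≠ 0 := by
    rw [← neg_sub, neg_ne_zero, ← C_1]
    exact X_sub_C_ne_zero 1
  have hrev : (1 - X : R[X]).reverse = -(1 - X) := by
    have hdeg : (1 - X : R[X]).natDegree = 1 := by
      rw [← neg_sub, natDegree_neg, ← C_1, natDegree_X_sub_C]
    rw [reverse, hdeg, reflect_sub, reflect_one, reflect_one_X]
    ring
  have hmul : (1 - X : R[X]).reverse * (-k).reverse = -((1 - X) * -k) := by
    rw [← reverse_mul_of_domain, ← hfk, hf]
  rw [hrev, neg_mul, neg_inj] at hmul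
  exact mul_left_cancel₀ hne hmul

/-- If `n` is odd, `g ∈ SU(n)` and the characteristic polynomial `f` of `g` has real
coefficients, then `f = (1 - q) h` with `h` a reciprocal polynomial of degree `n - 1`. -/
theorem charpoly_specialUnitary_odd_real_factor_reciprocal
    (n : ℕ) (hn : Odd n) (g : Matrix.specialUnitaryGroup (Fin n) ℂ)
    (f : Polynomial ℂ) (hf : f = Matrix.charpoly (g : Matrix (Fin n) (Fin n) ℂ))
    (hreal : ∀ k, (f.coeff k).im = 0) :
    ∃ h : Polynomial ℂ, h.natDegree = n - 1 ∧ f = (1 - X) * h ∧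
      ∀ k ≤ n - 1, h.coeff k = h.coeff (n - 1 - k) := by
  obtain ⟨A, hA⟩ := g
  obtain ⟨hU, hdet⟩ := Matrix.mem_specialUnitaryGroup_iff.mp hA
  simp only at hf
  have hinv : A⁻¹ = A.conjTranspose :=
    Matrix.inv_eq_left_inv (Matrix.mem_unitaryGroup_iff'.mp hU)
  have hconj : f.map (starRingEnd ℂ) = f := by
    ext1 k
    rw [coeff_map]
    exact Complex.conj_eq_iff_im.mpr (hreal k)
  have hfrev : f.reverse = -f := by
    have key := Matrix.charpoly_inv A ((Matrix.isUnit_iff_isUnit_det A).mpr (by simp [hdet]))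
    rw [hinv, Matrix.charpoly_conjTranspose_eq_map, ← hf, hconj, ← Matrix.reverse_charpoly, ← hf,
      hdet, Fintype.card_fin, hn.neg_one_pow] at key
    simp only [Ring.inverse_one, C_1, mul_one, neg_mul, one_mul] at key
    rw [eq_neg_iff_add_eq_zero, add_comm, ← eq_neg_iff_add_eq_zero]
    exact key
  obtain ⟨h, hfh, hrev⟩ := exists_eq_one_sub_X_mul_of_reverse_eq_neg hfrev
  have hdeg : h.natDegree = n - 1 := by
    have hfdeg : f.natDegree = n := by rw [hf, Matrix.charpoly_natDegree_eq_dim, Fintype.card_fin]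
    have hf0 : f ≠ 0 := hf ▸ (Matrix.charpoly_monic A).ne_zero
    rw [hfh] at hf0
    rw [hfh, natDegree_mul (left_ne_zero_of_mul hf0) (right_ne_zero_of_mul hf0), ← neg_sub,
      natDegree_neg, ← C_1, natDegree_X_sub_C] at hfdeg
    omega
  refine ⟨h, hdeg, hfh, fun k hk => ?_⟩
  rw [← hdeg] at hk ⊢
  rw [← revAt_le hk, ← coeff_reverse, hrev]
end

section
/- Let t be the variable of the field of rational functions ℚ(t), set q = t² and z = t⁻¹ - t, and define G₁(-q) = 1/(1+q)² + 1/(1-q)² + 1/(1+q²) + 2/(1+q+q²) + 2/(1-q+q²) as an element of ℚ(t). Then the identity q·G₁(-q)/z = 1/(z(z²+4)) + 1/z³ + 1/(z(z²+2)) + 2/(z(z²+3)) + 2/(z(z²+1)) holds in ℚ(t). -/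
/-- In `ℚ(t)`, with `q = t²`, `z = t⁻¹ - t` and
`G₁(-q) = 1/(1+q)² + 1/(1-q)² + 1/(1+q²) + 2/(1+q+q²) + 2/(1-q+q²)`
(the Molien sum of the binary tetrahedral group evaluated at `-q`), one has
`q·G₁(-q)/z = 1/(z(z²+4)) + 1/z³ + 1/(z(z²+2)) + 2/(z(z²+3)) + 2/(z(z²+1))`. -/
theorem binary_tetrahedral_molien_q_fraction_decomposition :
    let t : RatFunc ℚ := RatFunc.X
    let q : RatFunc ℚ := t ^ 2
    let z : RatFunc ℚ := t⁻¹ - t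
    q * (1 / (1 + q) ^ 2 + 1 / (1 - q) ^ 2 + 1 / (1 + q ^ 2) +
          2 / (1 + q + q ^ 2) + 2 / (1 - q + q ^ 2)) / z =
      1 / (z * (z ^ 2 + 4)) + 1 / z ^ 3 + 1 / (z * (z ^ 2 + 2)) +
        2 / (z * (z ^ 2 + 3)) + 2 / (z * (z ^ 2 + 1)) := by
  intro t q z
  have ht : t ≠ 0 := RatFunc.X_ne_zero
  have h0 : z ^ 2 = (1 - q) ^ 2 / q := by simp only [z, q]; field_simp
  have h4 : z ^ 2 + 4 = (1 + q) ^ 2 / q := by simp only [z, q]; field_simp; ring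
  have h2 : z ^ 2 + 2 = (1 + q ^ 2) / q := by simp only [z, q]; field_simp; ring
  have h3 : z ^ 2 + 3 = (1 + q + q ^ 2) / q := by simp only [z, q]; field_simp; ring
  have h1 : z ^ 2 + 1 = (1 - q + q ^ 2) / q := by simp only [z, q]; field_simp; ring
  have term (a D : RatFunc ℚ) : a / (z * (D / q)) = q * (a / D) / z := by
    simp only [div_eq_mul_inv, mul_inv, inv_inv]; ring
  rw [pow_succ' z 2, h4, h2, h3, h1, h0]
  simp only [term]
  ring
end
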